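/- (Xu–Chen) Let T be a k-additive t-periodic triangulated category, t an odd positive integer, with finite-dimensional Hom-spaces and local endomorphism rings of indecomposables. Then for all objects X, Y, L of T: (|Hom_T(L,X)_{Y[1]}| / a_X) · ( ∏_{i=1}^{t} ( |Hom_T(L[i],X)| / |Hom_T(X[i],X)| )^{(-1)^i} )^{1/2} = (|Hom_T(Y,L)_X| / a_Y) · ( ∏_{i=1}^{t} ( |Hom_T(Y[i],L)| / |Hom_T(Y[i],Y)| )^{(-1)^i} )^{1/2}; denoting this common value by F^L_{XY}, one has the derived Riedtmann–Peng formula F^L_{XY} = |Hom_T(X, Y[1])_{L[1]}| · {X, Y[1]}^{1/2} · ( a_L {L,L}^{1/2} ) / ( a_X {X,X}^{1/2} · a_Y {Y,Y}^{1/2} ), where {X,Y} := ∏_{i=1}^{t} |Hom_T(X[i],Y)|^{(-1)^i}. -/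

import Mathlib

/-!
STATEMENT 8 (Xu–Chen).
Let `T` be a `k`-additive `t`-periodic triangulated category (`t` an odd positive integer)
with finite-dimensional Hom-spaces and local endomorphism rings of indecomposables.
Then for all `X Y L` the two expressions defining `F^L_{XY}` agree, and the derived
Riedtmann–Peng formula holds, where `{X, Y} := ∏_{i=1}^{t} |Hom(X[i], Y)|^{(-1)^i}`.
-/

open CategoryTheory CategoryTheory.Limits CategoryTheory.Pretriangulated

noncomputable section

namespace GreenDH

def autCard {C : Type*} [Category C] (X : C) : ℕ := Nat.card (Aut X)

variable {T : Type*} [Category T] [Preadditive T] [HasZeroObject T] [HasShift T ℤ]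
  [∀ n : ℤ, (shiftFunctor T n).Additive] [Pretriangulated T]

/-- `|Hom_T(Y, L)_X|`: the number of morphisms `Y ⟶ L` whose cone is isomorphic to `X`. -/
def coneHomCard (Y L X : T) : ℕ :=
  Nat.card {l : Y ⟶ L // ∃ (g : L ⟶ X) (h : X ⟶ Y⟦(1 : ℤ)⟧),
    Triangle.mk l g h ∈ distinguishedTriangles (C := T)}

/-- `{X, Y} := ∏_{i=1}^{t} |Hom_T(X[i], Y)|^{(-1)^i}`. -/
def braceT (t : ℕ) (X Y : T) : ℝ :=
  ∏ i ∈ Finset.Icc 1 t, (Nat.card (X⟦(i : ℤ)⟧ ⟶ Y) : ℝ) ^ ((-1 : ℤ) ^ i)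

section Helpers

set_option linter.unusedSectionVars false

lemma card_ker_range {A B : Type*} [AddCommGroup A] [AddCommGroup B] (φ : A →+ B) :
    Nat.card A = Nat.card φ.ker * Nat.card φ.range := by
  rw [AddSubgroup.card_eq_card_quotient_mul_card_addSubgroup φ.ker, mul_comm,
    Nat.card_congr (QuotientAddGroup.quotientKerEquivRange φ).toEquiv]

/-- size of the image of precomposition with `f` -/
def preR {P Q : T} (f : P ⟶ Q) (Z : T) : ℕ := Nat.card (Preadditive.leftComp Z f).range

/-- size of the image of postcomposition with `g` -/
def postR {Q R : T} (g : Q ⟶ R) (Z : T) : ℕ := Nat.card (Preadditive.rightComp Z g).range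

lemma preR_iso {P Q : T} (f : P ⟶ Q) {Z Z' : T} (e : Z ≅ Z') : preR f Z = preR f Z' := by
  refine Nat.card_congr ((Iso.homCongr (Iso.refl P) e).subtypeEquiv ?_)
  intro x
  constructor
  · rintro ⟨y, rfl⟩
    exact ⟨y ≫ e.hom, by simp [Preadditive.leftComp]⟩
  · rintro ⟨y, hy⟩
    refine ⟨y ≫ e.inv, ?_⟩
    simp [Preadditive.leftComp] at hy ⊢
    rw [reassoc_of% hy]; simp

lemma postR_iso {Q R : T} (g : Q ⟶ R) {Z Z' : T} (e : Z ≅ Z') : postR g Z = postR g Z' := by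
  refine Nat.card_congr ((Iso.homCongr e (Iso.refl R)).subtypeEquiv ?_)
  intro x
  constructor
  · rintro ⟨y, rfl⟩
    exact ⟨e.inv ≫ y, by simp [Preadditive.rightComp]⟩
  · rintro ⟨y, hy⟩
    refine ⟨e.hom ≫ y, ?_⟩
    simp [Preadditive.rightComp] at hy ⊢
    simp [hy]

lemma preR_shift {P Q : T} (f : P ⟶ Q) (Z : T) :
    preR (f⟦(1 : ℤ)⟧') (Z⟦(1 : ℤ)⟧) = preR f Z := by
  symm
  let F := (Functor.FullyFaithful.ofFullyFaithful (shiftFunctor T (1 : ℤ)))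
  refine Nat.card_congr ((F.homEquiv (X := P) (Y := Z)).subtypeEquiv ?_)
  intro x
  constructor
  · rintro ⟨y, rfl⟩
    exact ⟨y⟦(1 : ℤ)⟧', by simp [Preadditive.leftComp, Functor.FullyFaithful.homEquiv]⟩
  · rintro ⟨y, hy⟩
    refine ⟨F.preimage y, ?_⟩
    apply (shiftFunctor T (1 : ℤ)).map_injective
    simpa [Preadditive.leftComp, Functor.FullyFaithful.homEquiv] using hy

lemma card_shift_hom (P Z : T) :
    Nat.card (P⟦(1 : ℤ)⟧ ⟶ Z⟦(1 : ℤ)⟧) = Nat.card (P ⟶ Z) :=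
  (Nat.card_congr (Functor.FullyFaithful.ofFullyFaithful
    (shiftFunctor T (1 : ℤ))).homEquiv).symm

lemma card_hom_iso {P P' Z Z' : T} (e : P ≅ P') (e' : Z ≅ Z') :
    Nat.card (P ⟶ Z) = Nat.card (P' ⟶ Z') :=
  Nat.card_congr (Iso.homCongr e e')

lemma card_hom_adj (P Z : T) (i : ℤ) :
    Nat.card (P⟦i⟧ ⟶ Z) = Nat.card (P ⟶ Z⟦-i⟧) :=
  Nat.card_congr ((shiftEquiv T i).toAdjunction.homEquiv P Z)

/-- kernel of precomposition with the third map -/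
lemma ker_left_mor₃ {P Q R : T} {f : P ⟶ Q} {g : Q ⟶ R} {h : R ⟶ P⟦(1 : ℤ)⟧}
    (w : Triangle.mk f g h ∈ distTriang T) (Z : T) :
    (Preadditive.leftComp Z h).ker = (Preadditive.leftComp Z (f⟦(1 : ℤ)⟧')).range := by
  ext x
  constructor
  · intro hx
    have hy2 : ∃ y : Q⟦(1 : ℤ)⟧ ⟶ Z, x = (-f⟦(1 : ℤ)⟧') ≫ y :=
      Triangle.yoneda_exact₃ _ (rot_of_distTriang _ w) x hx
    obtain ⟨y, hy⟩ := hy2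
    exact ⟨-y, by simp [Preadditive.leftComp, hy]⟩
  · rintro ⟨y, rfl⟩
    have : h ≫ f⟦(1 : ℤ)⟧' = 0 := comp_distTriang_mor_zero₃₁ _ w
    simp [Preadditive.leftComp, AddMonoidHom.mem_ker, reassoc_of% this]

lemma ker_left_mor₂ {P Q R : T} {f : P ⟶ Q} {g : Q ⟶ R} {h : R ⟶ P⟦(1 : ℤ)⟧}
    (w : Triangle.mk f g h ∈ distTriang T) (Z : T) :
    (Preadditive.leftComp Z g).ker = (Preadditive.leftComp Z h).range := by
  ext x
  constructor
  · intro hx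
    obtain ⟨y, hy⟩ := Triangle.yoneda_exact₃ _ w x hx
    exact ⟨y, hy.symm⟩
  · rintro ⟨y, rfl⟩
    have : g ≫ h = 0 := comp_distTriang_mor_zero₂₃ _ w
    simp [Preadditive.leftComp, AddMonoidHom.mem_ker, reassoc_of% this]

lemma ker_left_mor₁ {P Q R : T} {f : P ⟶ Q} {g : Q ⟶ R} {h : R ⟶ P⟦(1 : ℤ)⟧}
    (w : Triangle.mk f g h ∈ distTriang T) (Z : T) :
    (Preadditive.leftComp Z f).ker = (Preadditive.leftComp Z g).range := by
  ext x
  constructor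
  · intro hx
    obtain ⟨y, hy⟩ := Triangle.yoneda_exact₂ _ w x hx
    exact ⟨y, hy.symm⟩
  · rintro ⟨y, rfl⟩
    have : f ≫ g = 0 := comp_distTriang_mor_zero₁₂ _ w
    simp [Preadditive.leftComp, AddMonoidHom.mem_ker, reassoc_of% this]

lemma ker_right_mor₃ {P Q R : T} {f : P ⟶ Q} {g : Q ⟶ R} {h : R ⟶ P⟦(1 : ℤ)⟧}
    (w : Triangle.mk f g h ∈ distTriang T) (Z : T) :
    (Preadditive.rightComp Z h).ker = (Preadditive.rightComp Z g).range := by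
  ext x
  constructor
  · intro hx
    obtain ⟨y, hy⟩ := Triangle.coyoneda_exact₃ _ w x hx
    exact ⟨y, hy.symm⟩
  · rintro ⟨y, rfl⟩
    have : g ≫ h = 0 := comp_distTriang_mor_zero₂₃ _ w
    simp [Preadditive.rightComp, AddMonoidHom.mem_ker, this]

lemma ker_right_mor₁ {P Q R : T} {f : P ⟶ Q} {g : Q ⟶ R} {h : R ⟶ P⟦(1 : ℤ)⟧}
    (w : Triangle.mk f g h ∈ distTriang T) (Z : T) :
    (Preadditive.rightComp Z (f⟦(1 : ℤ)⟧')).ker = (Preadditive.rightComp Z h).range := by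
  ext x
  constructor
  · intro hx
    obtain ⟨y, hy⟩ := Triangle.coyoneda_exact₁ _ w x hx
    exact ⟨y, hy.symm⟩
  · rintro ⟨y, rfl⟩
    have : h ≫ f⟦(1 : ℤ)⟧' = 0 := comp_distTriang_mor_zero₃₁ _ w
    simp [Preadditive.rightComp, AddMonoidHom.mem_ker, this]

lemma ker_right_mor₂ {P Q R : T} {f : P ⟶ Q} {g : Q ⟶ R} {h : R ⟶ P⟦(1 : ℤ)⟧}
    (w : Triangle.mk f g h ∈ distTriang T) (Z : T) :
    (Preadditive.rightComp Z g).ker = (Preadditive.rightComp Z f).range := by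
  ext x
  constructor
  · intro hx
    obtain ⟨y, hy⟩ := Triangle.coyoneda_exact₂ _ w x hx
    exact ⟨y, hy.symm⟩
  · rintro ⟨y, rfl⟩
    have : f ≫ g = 0 := comp_distTriang_mor_zero₁₂ _ w
    simp [Preadditive.rightComp, AddMonoidHom.mem_ker, this]

lemma les_contra {P Q R : T} {f : P ⟶ Q} {g : Q ⟶ R} {h : R ⟶ P⟦(1 : ℤ)⟧}
    (w : Triangle.mk f g h ∈ distTriang T) (Z : T) :
    Nat.card (Q ⟶ Z⟦(1 : ℤ)⟧) * Nat.card (P ⟶ Z) =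
      Nat.card (R ⟶ Z⟦(1 : ℤ)⟧) * (preR f (Z⟦(1 : ℤ)⟧) * preR f Z) := by
  rw [← card_shift_hom P Z, ← preR_shift f Z,
    card_ker_range (Preadditive.leftComp (Z⟦(1 : ℤ)⟧) f), ker_left_mor₁ w,
    card_ker_range (Preadditive.leftComp (Z⟦(1 : ℤ)⟧) g), ker_left_mor₂ w,
    card_ker_range (Preadditive.leftComp (Z⟦(1 : ℤ)⟧) h), ker_left_mor₃ w, preR, preR]
  ring

lemma card_range_right_shift {P Q : T} (f : P ⟶ Q) (Z : T) :
    postR (f⟦(1 : ℤ)⟧') (Z⟦(1 : ℤ)⟧) = postR f Z := by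
  symm
  let F := (Functor.FullyFaithful.ofFullyFaithful (shiftFunctor T (1 : ℤ)))
  refine Nat.card_congr ((F.homEquiv (X := Z) (Y := Q)).subtypeEquiv ?_)
  intro x
  constructor
  · rintro ⟨y, rfl⟩
    exact ⟨y⟦(1 : ℤ)⟧', by simp [Preadditive.rightComp, Functor.FullyFaithful.homEquiv]⟩
  · rintro ⟨y, hy⟩
    refine ⟨F.preimage y, ?_⟩
    apply (shiftFunctor T (1 : ℤ)).map_injective
    simpa [Preadditive.rightComp, Functor.FullyFaithful.homEquiv] using hy

lemma les_co {P Q R : T} {f : P ⟶ Q} {g : Q ⟶ R} {h : R ⟶ P⟦(1 : ℤ)⟧}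
    (w : Triangle.mk f g h ∈ distTriang T) (Z : T) :
    Nat.card (Z ⟶ Q) * Nat.card (Z⟦(1 : ℤ)⟧ ⟶ R) =
      Nat.card (Z ⟶ P) * (postR g Z * postR g (Z⟦(1 : ℤ)⟧)) := by
  rw [← card_shift_hom Z P,
    card_ker_range (Preadditive.rightComp Z g), ker_right_mor₂ w,
    card_ker_range (Preadditive.rightComp (Z⟦(1 : ℤ)⟧) h), ker_right_mor₃ w,
    card_ker_range (Preadditive.rightComp (Z⟦(1 : ℤ)⟧) (f⟦(1 : ℤ)⟧')), ker_right_mor₁ w]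
  have := card_range_right_shift f Z
  simp only [postR] at this ⊢
  rw [this]
  ring

lemma telescope (a : ℕ → ℝ) (ha : ∀ i, 0 < a i) (t : ℕ) :
    ∏ i ∈ Finset.Icc 1 t, (a i * a (i + 1)) ^ ((-1 : ℤ) ^ i) =
      (a 1)⁻¹ * (a (t + 1)) ^ ((-1 : ℤ) ^ t) := by
  induction t with
  | zero => simp [(ha 1).ne']
  | succ n ih =>
    rw [Finset.prod_Icc_succ_top (by omega), ih, mul_zpow, pow_succ (-1 : ℤ) n]
    have := (ha (n + 1)).ne'
    simp only [mul_neg_one, zpow_neg]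
    field_simp

lemma telescope' (q y r a : ℕ → ℝ) 
    (ha : ∀ i, 0 < a i) (t : ℕ) (ht : Odd t) (hper : a (t + 1) = a 1)
    (H : ∀ i, q i * y i = r i * (a i * a (i + 1))) :
    (∏ i ∈ Finset.Icc 1 t, q i ^ ((-1 : ℤ) ^ i)) * (∏ i ∈ Finset.Icc 1 t, y i ^ ((-1 : ℤ) ^ i))
      * a 1 ^ 2 = ∏ i ∈ Finset.Icc 1 t, r i ^ ((-1 : ℤ) ^ i) := by
  rw [← Finset.prod_mul_distrib]
  simp_rw [← mul_zpow, H, mul_zpow (r _)]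
  rw [Finset.prod_mul_distrib, telescope a ha, hper, ht.neg_one_pow]
  have := (ha 1).ne'
  simp
  field_simp

/-- distinguished triangles on fixed objects -/
def TriSet (P Q R : T) : Type _ :=
  {w : (P ⟶ Q) × (Q ⟶ R) × (R ⟶ P⟦(1 : ℤ)⟧) // Triangle.mk w.1 w.2.1 w.2.2 ∈ distTriang T}

/-- the endomorphisms of the cone killed by the two adjacent maps -/
def SSet {P Q R : T} (w : TriSet P Q R) : Type _ :=
  {β : R ⟶ R // w.1.2.1 ≫ β = 0 ∧ β ≫ w.1.2.2 = 0}

lemma rot_aux {P Q : T} (u : P⟦(1 : ℤ)⟧ ⟶ Q⟦(1 : ℤ)⟧) :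
    -((-(shiftFunctor T (1 : ℤ)).preimage u)⟦(1 : ℤ)⟧') = u := by
  rw [Functor.map_neg, Functor.map_preimage, neg_neg]

lemma rot_aux' {P Q : T} (u : P ⟶ Q) :
    -((shiftFunctor T (1 : ℤ)).preimage (-(u⟦(1 : ℤ)⟧'))) = u := by
  apply (shiftFunctor T (1 : ℤ)).map_injective
  rw [Functor.map_neg, Functor.map_preimage, neg_neg]

/-- rotation -/
def rotE (P Q R : T) : TriSet P Q R ≃ TriSet Q R (P⟦(1 : ℤ)⟧) where
  toFun w := ⟨(w.1.2.1, w.1.2.2, -w.1.1⟦(1 : ℤ)⟧'), rot_of_distTriang _ w.2⟩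
  invFun w := ⟨(-(shiftFunctor T (1 : ℤ)).preimage w.1.2.2, w.1.1, w.1.2.1), by
    rw [rotate_distinguished_triangle]
    have := w.2
    rw [← rot_aux w.1.2.2] at this
    exact this⟩
  left_inv w := Subtype.ext (Prod.ext (rot_aux' _) rfl)
  right_inv w := Subtype.ext (Prod.ext rfl (Prod.ext rfl (rot_aux _)))

lemma S_rel_aux {A B : T} (m : A ⟶ B) [∀ X Y : T, Finite (X ⟶ Y)] :
    Nat.card {β : A ⟶ A // (∃ γ : B ⟶ A, β = m ≫ γ) ∧ β ≫ m = 0} *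
        Nat.card (Preadditive.leftComp A m).ker =
      Nat.card {β : B ⟶ B // (∃ γ : B ⟶ A, β = γ ≫ m) ∧ m ≫ β = 0} *
        Nat.card (Preadditive.rightComp B m).ker := by
  let D : AddSubgroup (B ⟶ A) :=
    ((Preadditive.leftComp B m).comp (Preadditive.rightComp B m)).ker
  have hD : ∀ γ, γ ∈ D ↔ m ≫ γ ≫ m = 0 := fun γ => Iff.rfl
  have h1 := card_ker_range ((Preadditive.leftComp A m).comp D.subtype)
  have h2 := card_ker_range ((Preadditive.rightComp B m).comp D.subtype)
  have e1 : Nat.card ((Preadditive.leftComp A m).comp D.subtype).ker =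
      Nat.card (Preadditive.leftComp A m).ker := by
    refine Nat.card_congr ⟨fun x => ⟨x.1.1, x.2⟩, fun x => ⟨⟨x.1, ?_⟩, x.2⟩, fun _ => rfl,
      fun _ => rfl⟩
    have hx : m ≫ x.1 = 0 := x.2
    rw [hD, reassoc_of% hx]; simp
  have e2 : Nat.card ((Preadditive.rightComp B m).comp D.subtype).ker =
      Nat.card (Preadditive.rightComp B m).ker := by
    refine Nat.card_congr ⟨fun x => ⟨x.1.1, x.2⟩, fun x => ⟨⟨x.1, ?_⟩, x.2⟩, fun _ => rfl,
      fun _ => rfl⟩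
    have hx : x.1 ≫ m = 0 := x.2
    rw [hD, hx]; simp
  have e3 : Nat.card ((Preadditive.leftComp A m).comp D.subtype).range =
      Nat.card {β : A ⟶ A // (∃ γ : B ⟶ A, β = m ≫ γ) ∧ β ≫ m = 0} := by
    refine Nat.card_congr (Equiv.subtypeEquivRight fun β => ?_)
    constructor
    · rintro ⟨⟨γ, hγ⟩, rfl⟩
      exact ⟨⟨γ, rfl⟩, (Category.assoc _ _ _).trans ((hD γ).1 hγ)⟩
    · rintro ⟨⟨γ, rfl⟩, h⟩
      exact ⟨⟨γ, by simpa [hD] using h⟩, rfl⟩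
  have e4 : Nat.card ((Preadditive.rightComp B m).comp D.subtype).range =
      Nat.card {β : B ⟶ B // (∃ γ : B ⟶ A, β = γ ≫ m) ∧ m ≫ β = 0} := by
    refine Nat.card_congr (Equiv.subtypeEquivRight fun β => ?_)
    constructor
    · rintro ⟨⟨γ, hγ⟩, rfl⟩
      exact ⟨⟨γ, rfl⟩, (hD γ).1 hγ⟩
    · rintro ⟨⟨γ, rfl⟩, h⟩
      exact ⟨⟨γ, by simpa [hD] using h⟩, rfl⟩
  rw [← e1, ← e2, ← e3, ← e4, mul_comm, ← h1, h2, mul_comm]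

lemma S_rel [∀ X Y : T, Finite (X ⟶ Y)] {P Q R : T} (w : TriSet P Q R) :
    Nat.card (SSet w) * preR w.1.1 (R⟦(-1 : ℤ)⟧) =
      Nat.card (SSet (rotE P Q R w)) * postR w.1.2.1 (P⟦(1 : ℤ)⟧) := by
  have h := S_rel_aux w.1.2.2
  rw [ker_left_mor₃ w.2, ker_right_mor₃ w.2] at h
  have e : (R⟦(-1 : ℤ)⟧)⟦(1 : ℤ)⟧ ≅ R := (shiftFunctorCompIsoId T (-1) 1 (by simp)).app R
  rw [← preR_shift, preR_iso _ e]
  have e1 : Nat.card (SSet w) = Nat.card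
      {β : R ⟶ R // (∃ γ : P⟦(1 : ℤ)⟧ ⟶ R, β = w.1.2.2 ≫ γ) ∧ β ≫ w.1.2.2 = 0} := by
    refine Nat.card_congr (Equiv.subtypeEquivRight fun β => and_congr_left fun _ => ?_)
    have := SetLike.ext_iff.1 (ker_left_mor₂ w.2 R) β
    refine Iff.trans this ?_
    exact exists_congr fun _ => eq_comm
  have e2 : Nat.card (SSet (rotE P Q R w)) = Nat.card
      {β : P⟦(1 : ℤ)⟧ ⟶ P⟦(1 : ℤ)⟧ // (∃ γ : P⟦(1 : ℤ)⟧ ⟶ R, β = γ ≫ w.1.2.2) ∧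
        w.1.2.2 ≫ β = 0} := by
    refine Nat.card_congr (Equiv.subtypeEquivRight fun β => ?_)
    rw [and_comm]
    refine and_congr_left fun _ => ?_
    have := SetLike.ext_iff.1 (ker_right_mor₁ w.2 (P⟦(1 : ℤ)⟧)) β
    refine Iff.trans ?_ (this.trans (exists_congr fun _ => eq_comm))
    change β ≫ (-(w.1.1⟦(1 : ℤ)⟧')) = 0 ↔ β ≫ (w.1.1⟦(1 : ℤ)⟧') = 0
    rw [Preadditive.comp_neg, neg_eq_zero]
  rw [e1, e2]
  exact h

lemma card_hom_pos [∀ X Y : T, Finite (X ⟶ Y)] (A B : T) : (0 : ℝ) < Nat.card (A ⟶ B) := by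
  exact_mod_cast Nat.card_pos

lemma preR_pos [∀ X Y : T, Finite (X ⟶ Y)] {P Q : T} (f : P ⟶ Q) (Z : T) : 0 < preR f Z :=
  Nat.card_pos

lemma postR_pos [∀ X Y : T, Finite (X ⟶ Y)] {P Q : T} (f : P ⟶ Q) (Z : T) : 0 < postR f Z :=
  Nat.card_pos

lemma braceT_pos [∀ X Y : T, Finite (X ⟶ Y)] (t : ℕ) (A B : T) : 0 < braceT t A B :=
  Finset.prod_pos fun _ _ => zpow_pos (card_hom_pos _ _) _

lemma brace_contra [∀ X Y : T, Finite (X ⟶ Y)] {t : ℕ} (ht : Odd t)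
    (hper : Nonempty (shiftFunctor T (t : ℤ) ≅ 𝟭 T)) {P Q R : T} {f : P ⟶ Q} {g : Q ⟶ R}
    {h : R ⟶ P⟦(1 : ℤ)⟧} (w : Triangle.mk f g h ∈ distTriang T) (Z : T) :
    braceT t Q Z * (∏ i ∈ Finset.Icc 1 t,
        (Nat.card (P⟦((i + 1 : ℕ) : ℤ)⟧ ⟶ Z) : ℝ) ^ ((-1 : ℤ) ^ i)) *
      (preR f (Z⟦(-1 : ℤ)⟧) : ℝ) ^ 2 = braceT t R Z := by
  have := telescope' (fun i => (Nat.card (Q⟦(i : ℤ)⟧ ⟶ Z) : ℝ))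
    (fun i => (Nat.card (P⟦((i + 1 : ℕ) : ℤ)⟧ ⟶ Z) : ℝ))
    (fun i => (Nat.card (R⟦(i : ℤ)⟧ ⟶ Z) : ℝ))
    (fun i => (preR f (Z⟦(-(i : ℤ))⟧) : ℝ)) (fun i => by exact_mod_cast preR_pos _ _) t ht ?_ ?_
  · simpa [braceT] using this
  · obtain ⟨e⟩ := hper
    have e2 : Z⟦(-((t + 1 : ℕ) : ℤ))⟧ ≅ Z⟦(-((1 : ℕ) : ℤ))⟧ :=
      (e.app _).symm ≪≫ ((shiftFunctorAdd' T (-((t + 1 : ℕ) : ℤ)) (t : ℤ) (-((1 : ℕ) : ℤ))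
        (by push_cast; ring)).app Z).symm
    simp only [preR_iso f e2]
  · intro i
    have e : (Z⟦(-((i + 1 : ℕ) : ℤ))⟧)⟦(1 : ℤ)⟧ ≅ Z⟦(-(i : ℤ))⟧ :=
      ((shiftFunctorAdd' T (-((i + 1 : ℕ) : ℤ)) (1 : ℤ) (-(i : ℤ))
        (by push_cast; ring)).app Z).symm
    have h0 := les_contra w (Z⟦(-((i + 1 : ℕ) : ℤ))⟧)
    rw [card_hom_iso (Iso.refl Q) e, card_hom_iso (Iso.refl R) e, preR_iso f e,
      ← card_hom_adj, ← card_hom_adj, ← card_hom_adj] at h0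
    exact_mod_cast h0

lemma brace_co [∀ X Y : T, Finite (X ⟶ Y)] {t : ℕ} (ht : Odd t)
    (hper : Nonempty (shiftFunctor T (t : ℤ) ≅ 𝟭 T)) {P Q R : T} {f : P ⟶ Q} {g : Q ⟶ R}
    {h : R ⟶ P⟦(1 : ℤ)⟧} (w : Triangle.mk f g h ∈ distTriang T) (Z : T) :
    braceT t Z Q * (∏ i ∈ Finset.Icc 1 t,
        (Nat.card (Z⟦((i + 1 : ℕ) : ℤ)⟧ ⟶ R) : ℝ) ^ ((-1 : ℤ) ^ i)) *
      (postR g (Z⟦(1 : ℤ)⟧) : ℝ) ^ 2 = braceT t Z P := by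
  have := telescope' (fun i => (Nat.card (Z⟦(i : ℤ)⟧ ⟶ Q) : ℝ))
    (fun i => (Nat.card (Z⟦((i + 1 : ℕ) : ℤ)⟧ ⟶ R) : ℝ))
    (fun i => (Nat.card (Z⟦(i : ℤ)⟧ ⟶ P) : ℝ))
    (fun i => (postR g (Z⟦(i : ℤ)⟧) : ℝ)) (fun i => by exact_mod_cast postR_pos _ _) t ht ?_ ?_
  · simpa [braceT] using this
  · obtain ⟨e⟩ := hper
    have e2 : Z⟦((t + 1 : ℕ) : ℤ)⟧ ≅ Z⟦((1 : ℕ) : ℤ)⟧ :=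
      (shiftFunctorAdd' T ((1 : ℕ) : ℤ) (t : ℤ) ((t + 1 : ℕ) : ℤ)
        (by push_cast; ring)).app Z ≪≫ e.app _
    simp only [postR_iso g e2]
  · intro i
    have e : (Z⟦(i : ℤ)⟧)⟦(1 : ℤ)⟧ ≅ Z⟦((i + 1 : ℕ) : ℤ)⟧ :=
      ((shiftFunctorAdd' T (i : ℤ) (1 : ℤ) ((i + 1 : ℕ) : ℤ)
        (by push_cast; ring)).app Z).symm
    have h0 := les_co w (Z⟦(i : ℤ)⟧)
    rw [card_hom_iso e (Iso.refl R), postR_iso g e] at h0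
    exact_mod_cast h0

lemma key [∀ X Y : T, Finite (X ⟶ Y)] {t : ℕ} (ht : Odd t)
    (hper : Nonempty (shiftFunctor T (t : ℤ) ≅ 𝟭 T)) {P Q R : T} (w : TriSet P Q R) :
    braceT t Q R * braceT t P P * (Nat.card (SSet (rotE P Q R w)) : ℝ) ^ 2 =
      braceT t P Q * braceT t R R * (Nat.card (SSet w) : ℝ) ^ 2 := by
  have h1 := brace_contra ht hper w.2 R
  have h2 := brace_co ht hper w.2 P
  have h3 : (Nat.card (SSet w) : ℝ) * preR w.1.1 (R⟦(-1 : ℤ)⟧) =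
      Nat.card (SSet (rotE P Q R w)) * postR w.1.2.1 (P⟦(1 : ℤ)⟧) := by exact_mod_cast S_rel w
  have hp : (0 : ℝ) < postR w.1.2.1 (P⟦(1 : ℤ)⟧) := by exact_mod_cast postR_pos _ _
  rw [← h1, ← h2]
  generalize (∏ i ∈ Finset.Icc 1 t,
        (Nat.card (P⟦((i + 1 : ℕ) : ℤ)⟧ ⟶ R) : ℝ) ^ ((-1 : ℤ) ^ i)) = E
  linear_combination (-braceT t Q R * braceT t P Q * E) * (((Nat.card (SSet w) : ℝ) * preR w.1.1 (R⟦(-1 : ℤ)⟧) +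
      Nat.card (SSet (rotE P Q R w)) * postR w.1.2.1 (P⟦(1 : ℤ)⟧))) * h3

lemma one_add_isIso {P Q R : T} (w : TriSet P Q R) (β : SSet w) :
    IsIso (𝟙 R + β.1) := by
  let φ : Triangle.mk w.1.1 w.1.2.1 w.1.2.2 ⟶ Triangle.mk w.1.1 w.1.2.1 w.1.2.2 :=
    Triangle.homMk _ _ (𝟙 P) (𝟙 Q) (𝟙 R + β.1) (by change w.1.1 ≫ 𝟙 Q = 𝟙 P ≫ w.1.1; simp)
      (by
        change w.1.2.1 ≫ (𝟙 R + β.1) = 𝟙 Q ≫ w.1.2.1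
        rw [Preadditive.comp_add, β.2.1]; simp)
      (by
        change w.1.2.2 ≫ (𝟙 P)⟦(1 : ℤ)⟧' = (𝟙 R + β.1) ≫ w.1.2.2
        rw [Preadditive.add_comp, β.2.2]; simp)
  exact isIso₃_of_isIso₁₂ φ w.2 w.2 (inferInstanceAs (IsIso (𝟙 P)))
    (inferInstanceAs (IsIso (𝟙 Q)))

lemma exists_aut {P Q R : T} (w w' : TriSet P Q R) (h : w'.1.1 = w.1.1) :
    ∃ α : R ≅ R, w.1.2.1 ≫ α.hom = w'.1.2.1 ∧ α.hom ≫ w'.1.2.2 = w.1.2.2 := by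
  obtain ⟨(c : R ⟶ R), hc1, hc2⟩ := complete_distinguished_triangle_morphism _ _ w.2 w'.2 (𝟙 P) (𝟙 Q)
    (by
      change w.1.1 ≫ 𝟙 Q = 𝟙 P ≫ w'.1.1
      rw [h]; simp)
  have hc1' : w.1.2.1 ≫ c = 𝟙 Q ≫ w'.1.2.1 := hc1
  have hc2' : w.1.2.2 ≫ (𝟙 P)⟦(1 : ℤ)⟧' = c ≫ w'.1.2.2 := hc2
  let φ : Triangle.mk w.1.1 w.1.2.1 w.1.2.2 ⟶ Triangle.mk w'.1.1 w'.1.2.1 w'.1.2.2 :=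
    Triangle.homMk _ _ (𝟙 P) (𝟙 Q) c (by
      change w.1.1 ≫ 𝟙 Q = 𝟙 P ≫ w'.1.1
      rw [h]; simp) hc1 hc2
  have : IsIso c := isIso₃_of_isIso₁₂ φ w.2 w'.2 (inferInstanceAs (IsIso (𝟙 P)))
    (inferInstanceAs (IsIso (𝟙 Q)))
  refine ⟨@asIso T _ R R c this, by simpa using hc1', by simpa using hc2'.symm⟩

/-- transport of a triangle along an automorphism of the cone -/
def actTri {P Q R : T} (w : TriSet P Q R) (α : R ≅ R) : TriSet P Q R :=
  ⟨(w.1.1, w.1.2.1 ≫ α.hom, α.inv ≫ w.1.2.2), by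
    refine isomorphic_distinguished _ w.2 _ ?_
    exact Triangle.isoMk _ _ (Iso.refl P) (Iso.refl Q) α.symm
      (by change w.1.1 ≫ 𝟙 Q = 𝟙 P ≫ w.1.1; simp)
      (by change (w.1.2.1 ≫ α.hom) ≫ α.inv = 𝟙 Q ≫ w.1.2.1; simp)
      (by change (α.inv ≫ w.1.2.2) ≫ (𝟙 P)⟦(1 : ℤ)⟧' = α.inv ≫ w.1.2.2; simp)⟩

lemma fibre_card {P Q R : T} (w : TriSet P Q R) :
    Nat.card {w' : TriSet P Q R // w'.1.1 = w.1.1} * Nat.card (SSet w) = autCard R := by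
  rw [← Nat.card_prod, autCard]
  choose α h1 h2 using fun w' : {w' : TriSet P Q R // w'.1.1 = w.1.1} => exists_aut w w'.1 w'.2
  have hi := one_add_isIso w
  let F : {w' : TriSet P Q R // w'.1.1 = w.1.1} × SSet w → (R ≅ R) := fun x =>
    (@asIso _ _ _ _ (𝟙 R + x.2.1) (hi x.2)) ≪≫ α x.1
  have F1 : ∀ x, w.1.2.1 ≫ (F x).hom = x.1.1.1.2.1 := by
    intro x
    change w.1.2.1 ≫ (𝟙 R + x.2.1) ≫ (α x.1).hom = _
    rw [Preadditive.add_comp, Preadditive.comp_add, ← Category.assoc _ x.2.1, x.2.2.1]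
    simp [h1]
  have F2 : ∀ x, (F x).hom ≫ x.1.1.1.2.2 = w.1.2.2 := by
    intro x
    change ((𝟙 R + x.2.1) ≫ (α x.1).hom) ≫ _ = _
    rw [Category.assoc, h2, Preadditive.add_comp, x.2.2.2]
    simp
  refine Nat.card_congr (Equiv.ofBijective F ⟨?_, ?_⟩)
  · intro x y hxy
    have hw : x.1 = y.1 := by
      apply Subtype.ext
      apply Subtype.ext
      refine Prod.ext (x.1.2.trans y.1.2.symm) (Prod.ext ?_ ?_)
      · rw [← F1, ← F1, hxy]
      · rw [← cancel_epi (F x).hom, F2, hxy, F2]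
    obtain ⟨x1, x2⟩ := x
    obtain ⟨y1, y2⟩ := y
    obtain rfl : x1 = y1 := hw
    have h3 : (𝟙 R + x2.1) ≫ (α x1).hom = (𝟙 R + y2.1) ≫ (α x1).hom :=
      congrArg (fun e : R ≅ R => e.hom) hxy
    rw [cancel_mono, add_right_inj] at h3
    exact Prod.ext rfl (Subtype.ext h3)
  · intro a
    let w' : {w' : TriSet P Q R // w'.1.1 = w.1.1} := ⟨actTri w a, rfl⟩
    have g1 : w.1.2.1 ≫ (α w').hom = w.1.2.1 ≫ a.hom := h1 w'
    have g2 : (α w').hom ≫ a.inv ≫ w.1.2.2 = w.1.2.2 := h2 w'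
    refine ⟨(w', ⟨a.hom ≫ (α w').inv - 𝟙 R, ?_, ?_⟩), ?_⟩
    · rw [Preadditive.comp_sub, ← reassoc_of% g1]; simp
    · rw [Preadditive.sub_comp, Category.assoc]
      nth_rw 1 [← g2]
      rw [Iso.inv_hom_id_assoc, sub_eq_zero, Category.id_comp]
      exact Iso.hom_inv_id_assoc (show R ≅ R from a) _
    · apply Iso.ext
      change (𝟙 R + (a.hom ≫ (α w').inv - 𝟙 R)) ≫ (α w').hom = a.hom
      simp

instance TriSet_finite [∀ X Y : T, Finite (X ⟶ Y)] (P Q R : T) : Finite (TriSet P Q R) :=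
  inferInstanceAs (Finite {_w : (P ⟶ Q) × (Q ⟶ R) × (R ⟶ P⟦(1 : ℤ)⟧) // _})

lemma autCard_pos [∀ X Y : T, Finite (X ⟶ Y)] (X : T) : (0 : ℝ) < autCard X := by
  have : Finite (Aut X) :=
    Finite.of_injective (fun a : Aut X => (show X ≅ X from a).hom) fun a b h => Iso.ext h
  have : 0 < Nat.card (Aut X) := Nat.card_pos
  exact_mod_cast this

open Classical in
lemma cone_card [∀ X Y : T, Finite (X ⟶ Y)] (P Q R : T) [Fintype (TriSet P Q R)] :
    (coneHomCard P Q R : ℝ) = (∑ w : TriSet P Q R, (Nat.card (SSet w) : ℝ)) / autCard R := by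
  let B := {l : P ⟶ Q // ∃ (g : Q ⟶ R) (h : R ⟶ P⟦(1 : ℤ)⟧),
    Triangle.mk l g h ∈ distinguishedTriangles (C := T)}
  have : Fintype B := Fintype.ofFinite _
  let p : TriSet P Q R → B := fun w => ⟨w.1.1, w.1.2.1, w.1.2.2, w.2⟩
  have hp := autCard_pos R
  rw [← Finset.sum_fiberwise Finset.univ p, Finset.sum_div]
  have : ∀ b : B, (∑ w with p w = b, (Nat.card (SSet w) : ℝ)) / autCard R = 1 := by
    intro b
    obtain ⟨l, g, h, hw⟩ := b
    let w0 : TriSet P Q R := ⟨(l, g, h), hw⟩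
    have hc : (Finset.univ.filter fun w => p w = p w0).card =
        Nat.card {w' : TriSet P Q R // w'.1.1 = w0.1.1} := by
      rw [Nat.card_eq_fintype_card, Fintype.card_subtype]
      congr 1
      ext w
      simp [p, B]
    change (∑ w with p w = p w0, (Nat.card (SSet w) : ℝ)) / autCard R = 1
    have hc0 : (0 : ℝ) < (Finset.univ.filter fun w => p w = p w0).card := by
      exact_mod_cast Finset.card_pos.2 ⟨w0, by simp⟩
    have : ∀ w ∈ Finset.univ.filter (fun w => p w = p w0), (Nat.card (SSet w) : ℝ) =
        autCard R / (Finset.univ.filter fun w => p w = p w0).card := by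
      intro w hw
      have hw' : w.1.1 = w0.1.1 := congrArg Subtype.val (Finset.mem_filter.1 hw).2
      have hf := fibre_card w
      rw [hw', ← hc] at hf
      rw [eq_div_iff hc0.ne', mul_comm]
      exact_mod_cast hf
    rw [Finset.sum_congr rfl this, Finset.sum_const, nsmul_eq_mul]
    field_simp
  rw [Finset.sum_congr rfl fun b _ => this b]
  simp [coneHomCard, B]

lemma autCard_shift (Y : T) : autCard (Y⟦(1 : ℤ)⟧) = autCard Y :=
  (Nat.card_congr ((Functor.FullyFaithful.ofFullyFaithful
    (shiftFunctor T (1 : ℤ))).autMulEquivOfFullyFaithful Y).toEquiv).symm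

lemma braceT_shift (t : ℕ) (Y : T) : braceT t (Y⟦(1 : ℤ)⟧) (Y⟦(1 : ℤ)⟧) = braceT t Y Y := by
  unfold braceT
  refine Finset.prod_congr rfl fun i _ => ?_
  rw [card_hom_iso (shiftComm Y (1 : ℤ) (i : ℤ)) (Iso.refl _), card_shift_hom]

lemma prod_div_brace (t : ℕ) (A B C D : T) :
    (∏ i ∈ Finset.Icc 1 t, ((Nat.card (A⟦(i : ℤ)⟧ ⟶ B) : ℝ) / (Nat.card (C⟦(i : ℤ)⟧ ⟶ D) : ℝ)) ^
            ((-1 : ℤ) ^ i)) = braceT t A B / braceT t C D := by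
  simp only [div_zpow, Finset.prod_div_distrib, braceT]

lemma key_sqrt [∀ X Y : T, Finite (X ⟶ Y)] {t : ℕ} (ht : Odd t)
    (hper : Nonempty (shiftFunctor T (t : ℤ) ≅ 𝟭 T)) {P Q R : T} (w : TriSet P Q R) :
    √(braceT t Q R) * √(braceT t P P) * (Nat.card (SSet (rotE P Q R w)) : ℝ) =
      √(braceT t P Q) * √(braceT t R R) * (Nat.card (SSet w) : ℝ) := by
  have h := congrArg Real.sqrt (key ht hper w)
  have h0 := fun A B : T => (braceT_pos t A B).le
  rwa [Real.sqrt_mul (mul_nonneg (h0 _ _) (h0 _ _)), Real.sqrt_mul (h0 _ _),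
    Real.sqrt_mul (mul_nonneg (h0 _ _) (h0 _ _)), Real.sqrt_mul (h0 _ _),
    Real.sqrt_sq (Nat.cast_nonneg _), Real.sqrt_sq (Nat.cast_nonneg _)] at h

end Helpers

theorem xu_chen_formula_and_derived_riedtmann_peng
    (k : Type) [Field k] [Fintype k]
    (T : Type*) [Category T] [Preadditive T] [CategoryTheory.Linear k T]
    [HasZeroObject T] [HasShift T ℤ] [∀ n : ℤ, (shiftFunctor T n).Additive]
    [Pretriangulated T] [HasBinaryBiproducts T]
    (t : ℕ) (ht : Odd t) (htpos : 0 < t)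
    -- (i) finite-dimensional Hom-spaces over the finite field `k`
    (hfin : ∀ X Y : T, Module.Finite k (X ⟶ Y))
    -- (ii) local endomorphism rings of indecomposables
    (hloc : ∀ X : T, Indecomposable X → IsLocalRing (End X))
    -- (iii) `t`-periodicity: `[1]^t = [t] ≅ Id`
    (hper : Nonempty (shiftFunctor T (t : ℤ) ≅ 𝟭 T))
    (X Y L : T) :
    -- the two expressions for `F^L_{XY}` agree
    ((coneHomCard L X (Y⟦(1 : ℤ)⟧) : ℝ) / (autCard X : ℝ)) *
        Real.sqrt (∏ i ∈ Finset.Icc 1 t,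
          ((Nat.card (L⟦(i : ℤ)⟧ ⟶ X) : ℝ) / (Nat.card (X⟦(i : ℤ)⟧ ⟶ X) : ℝ)) ^
            ((-1 : ℤ) ^ i))
      = ((coneHomCard Y L X : ℝ) / (autCard Y : ℝ)) *
          Real.sqrt (∏ i ∈ Finset.Icc 1 t,
            ((Nat.card (Y⟦(i : ℤ)⟧ ⟶ L) : ℝ) / (Nat.card (Y⟦(i : ℤ)⟧ ⟶ Y) : ℝ)) ^
              ((-1 : ℤ) ^ i))
    -- the derived Riedtmann–Peng formula
    ∧ ((coneHomCard Y L X : ℝ) / (autCard Y : ℝ)) *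
          Real.sqrt (∏ i ∈ Finset.Icc 1 t,
            ((Nat.card (Y⟦(i : ℤ)⟧ ⟶ L) : ℝ) / (Nat.card (Y⟦(i : ℤ)⟧ ⟶ Y) : ℝ)) ^
              ((-1 : ℤ) ^ i))
      = (coneHomCard X (Y⟦(1 : ℤ)⟧) (L⟦(1 : ℤ)⟧) : ℝ) *
          Real.sqrt (braceT t X (Y⟦(1 : ℤ)⟧)) *
          ((autCard L : ℝ) * Real.sqrt (braceT t L L)) /
          ((autCard X : ℝ) * Real.sqrt (braceT t X X) *
            ((autCard Y : ℝ) * Real.sqrt (braceT t Y Y))) := by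
  have : ∀ X Y : T, Finite (X ⟶ Y) := fun X Y =>
    have := hfin X Y
    Module.finite_of_finite k
  have := Fintype.ofFinite (TriSet Y L X)
  have := Fintype.ofFinite (TriSet L X (Y⟦(1 : ℤ)⟧))
  have := Fintype.ofFinite (TriSet X (Y⟦(1 : ℤ)⟧) (L⟦(1 : ℤ)⟧))
  have b0 := fun A B : T => (braceT_pos t A B).le
  have bp := fun A B : T => (Real.sqrt_pos.2 (braceT_pos t A B)).ne'
  have aX := (autCard_pos X).ne'
  have aY := (autCard_pos Y).ne'
  have aL := (autCard_pos L).ne'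
  have k1 : √(braceT t L X) * √(braceT t Y Y) *
      (∑ w : TriSet L X (Y⟦(1 : ℤ)⟧), (Nat.card (SSet w) : ℝ)) =
      √(braceT t Y L) * √(braceT t X X) * (∑ w : TriSet Y L X, (Nat.card (SSet w) : ℝ)) := by
    rw [← Equiv.sum_comp (rotE Y L X), Finset.mul_sum, Finset.mul_sum]
    exact Finset.sum_congr rfl fun w _ => key_sqrt ht hper w
  have k2 : √(braceT t X (Y⟦(1 : ℤ)⟧)) * √(braceT t L L) *
      (∑ w : TriSet X (Y⟦(1 : ℤ)⟧) (L⟦(1 : ℤ)⟧), (Nat.card (SSet w) : ℝ)) =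
      √(braceT t L X) * √(braceT t Y Y) *
      (∑ w : TriSet L X (Y⟦(1 : ℤ)⟧), (Nat.card (SSet w) : ℝ)) := by
    rw [← Equiv.sum_comp (rotE L X (Y⟦(1 : ℤ)⟧)), Finset.mul_sum, Finset.mul_sum,
      ← braceT_shift t Y]
    exact Finset.sum_congr rfl fun w _ => key_sqrt ht hper w
  rw [cone_card L X (Y⟦(1 : ℤ)⟧), cone_card Y L X, cone_card X (Y⟦(1 : ℤ)⟧) (L⟦(1 : ℤ)⟧),
    autCard_shift, autCard_shift, prod_div_brace, prod_div_brace, Real.sqrt_div (b0 _ _),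
    Real.sqrt_div (b0 _ _)]
  have bXX := bp X X
  have bYY := bp Y Y
  constructor
  · field_simp
    linear_combination k1
  · field_simp
    linear_combination - k1 - k2

end GreenDH
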